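/- arXiv:1808.04220 — 2 statements merged into one kernel-verified Lean document; each statement's English description precedes it below -/
import Mathlib

section
/- Let G be a finite simple graph with vertex ordering v₁,…,v_n and in-degree sequence (δ₁,…,δ_n), and for 0 ≤ i ≤ n let G_i be the subgraph of G induced on {v₁,…,v_i}. Then for every 1 ≤ i ≤ n one has τ₀(G_i) − τ₀(G_{i−1}) ≤ 1/((δ_i+1)(δ_i+2)) − 1/(i(i+1)), with equality if and only if the set {v_j : j < i, v_j adjacent to v_i} of earlier neighbors of v_i is a clique in G. -/
open Finset

/-- `τ₀` of a finite simple graph. -/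
noncomputable def tau0 {V : Type*} [Fintype V] (G : SimpleGraph V) : ℚ :=
  ((Fintype.card V : ℚ) + 1)⁻¹ *
    ∑ W : Finset V,
      (if W.Nonempty then (Nat.card (G.induce (↑W : Set V)).ConnectedComponent : ℚ) - 1 else 0) /
        ((Fintype.card V).choose W.card : ℚ)

/-- The weight `1 / ((m + 1) * C(m, k))`, i.e. the Beta integral `∫₀¹ xᵏ (1 - x)ᵐ⁻ᵏ dx`. -/
def betaWeight (m k : ℕ) : ℚ := (((m : ℚ) + 1) * (m.choose k : ℚ))⁻¹

lemma betaWeight_pos {m k : ℕ} (h : k ≤ m) : 0 < betaWeight m k := by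
  have : (0 : ℚ) < (m.choose k : ℚ) := by exact_mod_cast Nat.choose_pos h
  unfold betaWeight
  positivity

lemma betaWeight_succ_add {m k : ℕ} (h : k ≤ m) :
    betaWeight (m + 1) k + betaWeight (m + 1) (k + 1) = betaWeight m k := by
  obtain ⟨d, rfl⟩ := Nat.exists_eq_add_of_le h
  have h1 : (((k + d + 1).choose k : ℕ) : ℚ) * (d + 1) = (k + d + 1) * ((k + d).choose k : ℕ) := by
    have := Nat.choose_mul_succ_eq (k + d) k
    rw [show k + d + 1 - k = d + 1 by omega] at this
    have h' : (((k + d).choose k * (k + d + 1) : ℕ) : ℚ)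
        = ((k + d + 1).choose k * (d + 1) : ℕ) := by rw [this]
    push_cast at h'
    linarith
  have h2 : (((k + d + 1).choose (k + 1) : ℕ) : ℚ) * (k + 1)
      = (k + d + 1) * ((k + d).choose k : ℕ) := by
    have := Nat.add_one_mul_choose_eq (k + d) k
    have h' : (((k + d + 1) * (k + d).choose k : ℕ) : ℚ)
        = ((k + d + 1).choose (k + 1) * (k + 1) : ℕ) := by rw [this]
    push_cast at h'
    linarith
  have hpos : (0 : ℚ) < ((k + d).choose k : ℕ) := by exact_mod_cast Nat.choose_pos h
  have e1 : (((k + d + 1).choose k : ℕ) : ℚ) = (k + d + 1) * ((k + d).choose k : ℕ) / (d + 1) := by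
    rw [eq_div_iff (by positivity), h1]
  have e2 : (((k + d + 1).choose (k + 1) : ℕ) : ℚ)
      = (k + d + 1) * ((k + d).choose k : ℕ) / (k + 1) := by
    rw [eq_div_iff (by positivity), h2]
  unfold betaWeight
  rw [e1, e2]
  push_cast
  field_simp
  ring

lemma sum_powerset_betaWeight {V : Type*} [DecidableEq V] (S : Finset V) (d : ℕ) :
    ∑ U ∈ S.powerset, betaWeight (d + #S + 1) (#U + 1) = betaWeight (d + 1) 1 := by
  induction S using Finset.induction_on with
  | empty => simp
  | insert a S ha ih =>
    rw [Finset.sum_powerset_insert ha, ← ih, ← Finset.sum_add_distrib]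
    refine Finset.sum_congr rfl fun U hU => ?_
    have hU' := Finset.mem_powerset.1 hU
    have hc := Finset.card_le_card hU'
    rw [Finset.card_insert_of_notMem (fun h => ha (hU' h)), Finset.card_insert_of_notMem ha,
      ← betaWeight_succ_add (show #U + 1 ≤ d + #S + 1 by omega)]
    rfl

namespace SimpleGraph

variable {V : Type*} (G : SimpleGraph V)

lemma apply_eq_of_walk {α : Type*} {G : SimpleGraph V} {f : V → α}
    (hf : ∀ x y, G.Adj x y → f x = f y) {x y : V} (p : G.Walk x y) : f x = f y := by
  induction p with
  | nil => rfl
  | cons h _ ih => exact (hf _ _ h).trans ih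

/-- The map on connected components induced by adding a vertex to a vertex set. -/
def componentInsert (v : V) (U : Set V) :
    (G.induce U).ConnectedComponent → (G.induce (insert v U)).ConnectedComponent :=
  ConnectedComponent.map (induceHomOfLE G (Set.subset_insert v U)).toHom

lemma componentInsert_surjective {v a : V} {U : Set V} (ha : a ∈ U) (hva : G.Adj v a) :
    Function.Surjective (G.componentInsert v U) := by
  intro c
  induction c using ConnectedComponent.ind with
  | h x =>
    obtain ⟨x, rfl | hx⟩ := x
    · refine ⟨(G.induce U).connectedComponentMk ⟨a, ha⟩, ?_⟩
      refine ConnectedComponent.sound (Adj.reachable ?_)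
      exact hva.symm
    · exact ⟨(G.induce U).connectedComponentMk ⟨x, hx⟩, rfl⟩

lemma componentInsert_injective {v a : V} {U : Set V} (hv : v ∉ U) (ha : a ∈ U)
    (hclique : ∀ b ∈ U, G.Adj v b → b = a ∨ G.Adj b a) :
    Function.Injective (G.componentInsert v U) := by
  classical
  let r : ↥(insert v U) → (G.induce U).ConnectedComponent := fun x =>
    if h : x.1 ∈ U then (G.induce U).connectedComponentMk ⟨x.1, h⟩
    else (G.induce U).connectedComponentMk ⟨a, ha⟩
  have key : ∀ b (hb : b ∈ U), G.Adj v b →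
      (G.induce U).connectedComponentMk ⟨b, hb⟩ = (G.induce U).connectedComponentMk ⟨a, ha⟩ := by
    intro b hb hvb
    rcases hclique b hb hvb with rfl | h
    · rfl
    · refine ConnectedComponent.sound (Adj.reachable ?_)
      exact h
  have hr : ∀ x y, (G.induce (insert v U)).Adj x y → r x = r y := by
    rintro ⟨x, rfl | hx⟩ ⟨y, rfl | hy⟩ hxy
    · rfl
    · have hxy' : G.Adj x y := hxy
      simp only [r, hv, hy, dif_pos, dif_neg, not_false_eq_true]
      exact (key y hy hxy').symm
    · have hxy' : G.Adj x y := hxy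
      simp only [r, hv, hx, dif_pos, dif_neg, not_false_eq_true]
      exact key x hx hxy'.symm
    · simp only [r, hx, hy, dif_pos]
      refine ConnectedComponent.sound (Adj.reachable ?_)
      exact hxy
  refine Function.LeftInverse.injective
    (g := ConnectedComponent.lift r fun _ _ p _ => apply_eq_of_walk hr p) fun c => ?_
  induction c using ConnectedComponent.ind with
  | h x => exact dif_pos x.2

lemma card_component_insert_of_not_adj [Finite V] {v : V} {U : Set V} (hv : v ∉ U)
    (h : ∀ a ∈ U, ¬ G.Adj v a) :
    Nat.card (G.induce (insert v U)).ConnectedComponent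
      = Nat.card (G.induce U).ConnectedComponent + 1 := by
  classical
  let r : ↥(insert v U) → Option (G.induce U).ConnectedComponent := fun x =>
    if h : x.1 ∈ U then some ((G.induce U).connectedComponentMk ⟨x.1, h⟩) else none
  have hr : ∀ x y, (G.induce (insert v U)).Adj x y → r x = r y := by
    rintro ⟨x, rfl | hx⟩ ⟨y, rfl | hy⟩ hxy
    · rfl
    · exact absurd hxy (h y hy)
    · exact absurd hxy.symm (h x hx)
    · simp only [r, hx, hy, dif_pos]
      refine congrArg some (ConnectedComponent.sound (Adj.reachable ?_))
      exact hxy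
  let e : (G.induce (insert v U)).ConnectedComponent ≃ Option (G.induce U).ConnectedComponent :=
    { toFun := ConnectedComponent.lift r fun _ _ p _ => apply_eq_of_walk hr p
      invFun := fun o => o.elim
        ((G.induce (insert v U)).connectedComponentMk ⟨v, Set.mem_insert v U⟩)
        (G.componentInsert v U)
      left_inv := by
        intro c
        induction c using ConnectedComponent.ind with
        | h x =>
          obtain ⟨x, rfl | hx⟩ := x
          · simp [r, hv]
          · simp only [ConnectedComponent.lift_mk, r, hx, dif_pos]
            rfl
      right_inv := by
        rintro (_ | c)
        · simp [r, hv]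
        · induction c using ConnectedComponent.ind with
          | h x => exact dif_pos x.2 }
  rw [Nat.card_congr e, Finite.card_option]

lemma card_component_insert_pair_lt [Finite V] {v a b : V} (hab : a ≠ b) (hadj : ¬ G.Adj a b)
    (hva : G.Adj v a) (hvb : G.Adj v b) :
    Nat.card (G.induce (insert v {a, b})).ConnectedComponent
      < Nat.card (G.induce ({a, b} : Set V)).ConnectedComponent := by
  have hsurj := G.componentInsert_surjective (U := {a, b}) (Set.mem_insert a {b}) hva
  refine lt_of_le_of_ne (Nat.card_le_card_of_surjective _ hsurj) fun hcard => ?_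
  have hinj : Function.Injective (G.componentInsert v {a, b}) :=
    ((Nat.bijective_iff_surjective_and_card _).2 ⟨hsurj, hcard.symm⟩).1
  have hbot : ∀ x y, (G.induce ({a, b} : Set V)).Adj x y → x = y := by
    rintro ⟨x, rfl | rfl⟩ ⟨y, rfl | rfl⟩ hxy
    · rfl
    · exact absurd hxy hadj
    · exact absurd hxy.symm hadj
    · rfl
  have hb : b ∈ ({a, b} : Set V) := by simp
  have heq : (G.induce ({a, b} : Set V)).connectedComponentMk ⟨a, Set.mem_insert a {b}⟩
      = (G.induce ({a, b} : Set V)).connectedComponentMk ⟨b, hb⟩ := by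
    apply hinj
    refine ConnectedComponent.sound (Reachable.trans
      (v := (⟨v, Set.mem_insert v _⟩ : ↥(insert v ({a, b} : Set V))))
      (Adj.reachable ?_) (Adj.reachable ?_))
    · exact hva.symm
    · exact hvb
  obtain ⟨p⟩ := ConnectedComponent.exact heq
  exact hab (congrArg Subtype.val (apply_eq_of_walk (f := id) hbot p))

/-- The reduced zeroth Betti number of the subgraph induced on `W`. -/
noncomputable def reducedBetti (W : Finset V) : ℚ :=
  if W.Nonempty then (Nat.card (G.induce (↑W : Set V)).ConnectedComponent : ℚ) - 1 else 0

lemma reducedBetti_map_subtype {s : Set V} (W : Finset s) :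
    (G.induce s).reducedBetti W
      = G.reducedBetti (W.map (Function.Embedding.subtype (· ∈ s))) := by
  let e : (G.induce s).induce (↑W : Set s) ≃g
      G.induce (↑(W.map (Function.Embedding.subtype (· ∈ s))) : Set V) :=
    { toFun := fun x => ⟨x.1.1, by simp⟩
      invFun := fun x => ⟨⟨x.1, by
        obtain ⟨y, -, hy⟩ := Finset.mem_map.1 (Finset.mem_coe.1 x.2)
        exact hy ▸ y.2⟩, by
        obtain ⟨y, hyW, hy⟩ := Finset.mem_map.1 (Finset.mem_coe.1 x.2)
        have : y = ⟨x.1, hy ▸ y.2⟩ := Subtype.ext hy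
        exact this ▸ hyW⟩
      left_inv := fun _ => rfl
      right_inv := fun _ => rfl
      map_rel_iff' := Iff.rfl }
  simp only [reducedBetti, Finset.map_nonempty, Nat.card_congr e.connectedComponentEquiv]

lemma tau0_induce {s : Set V} [Fintype s] {S : Finset V} (hS : (S : Set V) = s) :
    tau0 (G.induce s) = ∑ W ∈ S.powerset, G.reducedBetti W * betaWeight #S #W := by
  subst hS
  have hcard : Fintype.card ↥(S : Set V) = #S := by
    rw [← Nat.card_eq_fintype_card]; simp
  unfold tau0
  rw [Finset.mul_sum, hcard]
  refine Finset.sum_bij (fun W _ => W.map (Function.Embedding.subtype (· ∈ (S : Set V))))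
    ?_ ?_ ?_ ?_
  · intro W _
    rw [Finset.mem_powerset]
    intro x hx
    obtain ⟨y, -, rfl⟩ := Finset.mem_map.1 hx
    exact y.2
  · intro W _ W' _ h
    exact Finset.map_injective _ h
  · intro W hW
    classical
    refine ⟨W.subtype (· ∈ (S : Set V)), Finset.mem_univ _, ?_⟩
    exact Finset.subtype_map_of_mem fun x hx => Finset.mem_powerset.1 hW hx
  · intro W _
    rw [← reducedBetti_map_subtype, Finset.card_map]
    unfold betaWeight
    rw [mul_inv, div_eq_mul_inv, reducedBetti]
    ring

lemma sum_insert_sub_sum_reducedBetti [DecidableEq V] {S : Finset V} {v : V} (hv : v ∉ S) :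
    ∑ W ∈ (insert v S).powerset, G.reducedBetti W * betaWeight #(insert v S) #W
        - ∑ W ∈ S.powerset, G.reducedBetti W * betaWeight #S #W
      = ∑ U ∈ S.powerset, (G.reducedBetti (insert v U) - G.reducedBetti U)
          * betaWeight (#S + 1) (#U + 1) := by
  rw [Finset.sum_powerset_insert hv, ← Finset.sum_add_distrib, ← Finset.sum_sub_distrib]
  refine Finset.sum_congr rfl fun U hU => ?_
  have hU' := Finset.mem_powerset.1 hU
  rw [Finset.card_insert_of_notMem hv, Finset.card_insert_of_notMem fun h => hv (hU' h),
    ← betaWeight_succ_add (Finset.card_le_card hU')]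
  ring

lemma reducedBetti_insert_sub [DecidableEq V] {U : Finset V} (hU : U.Nonempty) (v : V) :
    G.reducedBetti (insert v U) - G.reducedBetti U
      = (Nat.card (G.induce (insert v (↑U : Set V))).ConnectedComponent : ℚ)
        - Nat.card (G.induce (↑U : Set V)).ConnectedComponent := by
  simp only [reducedBetti, hU, Finset.insert_nonempty, if_true]
  rw [Finset.coe_insert]
  ring

lemma reducedBetti_insert_sub_of_disjoint [Finite V] [DecidableEq V] {U : Finset V} {v : V}
    (hv : v ∉ U) (h : ∀ a ∈ U, ¬ G.Adj v a) :
    G.reducedBetti (insert v U) - G.reducedBetti U = if U.Nonempty then 1 else 0 := by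
  split_ifs with hU
  · rw [reducedBetti_insert_sub G hU, G.card_component_insert_of_not_adj (by simpa using hv)
      (by simpa using h)]
    push_cast
    ring
  · rw [Finset.not_nonempty_iff_eq_empty] at hU
    subst hU
    have : Nat.card (G.induce (insert v (∅ : Set V))).ConnectedComponent = 1 := by
      rw [G.card_component_insert_of_not_adj (by simp) (by simp)]
      simp
    simp only [reducedBetti, Finset.insert_nonempty, Finset.not_nonempty_empty, if_true, if_false]
    rw [Finset.coe_insert, Finset.coe_empty, this]
    norm_num

lemma reducedBetti_insert_sub_nonpos [Finite V] [DecidableEq V] {U : Finset V} {v a : V}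
    (ha : a ∈ U) (hva : G.Adj v a) :
    G.reducedBetti (insert v U) - G.reducedBetti U ≤ 0 := by
  rw [reducedBetti_insert_sub G ⟨a, ha⟩, sub_nonpos, Nat.cast_le]
  exact Nat.card_le_card_of_surjective _
    (G.componentInsert_surjective (Finset.mem_coe.2 ha) hva)

lemma reducedBetti_insert_sub_eq_zero [DecidableEq V] {U : Finset V} {v a : V}
    (hv : v ∉ U) (ha : a ∈ U) (hva : G.Adj v a)
    (hclique : ∀ b ∈ U, G.Adj v b → b = a ∨ G.Adj b a) :
    G.reducedBetti (insert v U) - G.reducedBetti U = 0 := by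
  rw [reducedBetti_insert_sub G ⟨a, ha⟩, sub_eq_zero, Nat.cast_inj]
  exact (Nat.card_congr (Equiv.ofBijective _
    ⟨G.componentInsert_injective (by simpa using hv) (Finset.mem_coe.2 ha) (by simpa using hclique),
      G.componentInsert_surjective (Finset.mem_coe.2 ha) hva⟩)).symm

lemma sum_indicator_betaWeight [DecidableEq V] {S N : Finset V} (hN : N ⊆ S) :
    ∑ U ∈ S.powerset, (if U.Nonempty ∧ Disjoint U N then 1 else 0) * betaWeight (#S + 1) (#U + 1)
      = betaWeight (#N + 1) 1 - betaWeight (#S + 1) 1 := by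
  have hcard : #S = #N + #(S \ N) := by
    rw [Finset.card_sdiff_of_subset hN]
    have := Finset.card_le_card hN
    omega
  have hset : S.powerset.filter (fun U => U.Nonempty ∧ Disjoint U N)
      = (S \ N).powerset.erase ∅ := by
    ext U
    simp only [Finset.mem_filter, Finset.mem_erase, Finset.mem_powerset, Finset.subset_sdiff,
      Finset.nonempty_iff_ne_empty]
    tauto
  simp only [ite_mul, one_mul, zero_mul]
  rw [← Finset.sum_filter, hset, ← sum_powerset_betaWeight (S \ N) #N, ← hcard,
    ← Finset.sum_erase_add _ _ (Finset.empty_mem_powerset (S \ N))]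
  simp

lemma sum_reducedBetti_insert_sub_le [Finite V] [DecidableEq V] {S N : Finset V} {v : V}
    (hv : v ∉ S) (hN : ∀ a, a ∈ N ↔ a ∈ S ∧ G.Adj v a) :
    ∑ U ∈ S.powerset, (G.reducedBetti (insert v U) - G.reducedBetti U)
          * betaWeight (#S + 1) (#U + 1) ≤ betaWeight (#N + 1) 1 - betaWeight (#S + 1) 1 ∧
      (∑ U ∈ S.powerset, (G.reducedBetti (insert v U) - G.reducedBetti U)
          * betaWeight (#S + 1) (#U + 1) = betaWeight (#N + 1) 1 - betaWeight (#S + 1) 1 ↔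
        G.IsClique (↑N : Set V)) := by
  rw [← sum_indicator_betaWeight (S := S) (N := N) fun a ha => ((hN a).1 ha).1]
  have hpos : ∀ U ∈ S.powerset, 0 < betaWeight (#S + 1) (#U + 1) := fun U hU =>
    betaWeight_pos (Nat.succ_le_succ (Finset.card_le_card (Finset.mem_powerset.1 hU)))
  have hdisj : ∀ U ∈ S.powerset, Disjoint U N → G.reducedBetti (insert v U) - G.reducedBetti U
      = if U.Nonempty ∧ Disjoint U N then 1 else 0 := by
    intro U hU hd
    have hU' := Finset.mem_powerset.1 hU
    rw [G.reducedBetti_insert_sub_of_disjoint (fun h => hv (hU' h)) fun a ha hva =>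
      Finset.disjoint_left.1 hd ha ((hN a).2 ⟨hU' ha, hva⟩)]
    simp [hd]
  have hle : ∀ U ∈ S.powerset, G.reducedBetti (insert v U) - G.reducedBetti U
      ≤ if U.Nonempty ∧ Disjoint U N then 1 else 0 := by
    intro U hU
    by_cases hd : Disjoint U N
    · exact (hdisj U hU hd).le
    · obtain ⟨a, ha, haN⟩ := Finset.not_disjoint_iff.1 hd
      simpa [hd] using G.reducedBetti_insert_sub_nonpos ha ((hN a).1 haN).2
  have hle' : ∀ U ∈ S.powerset, (G.reducedBetti (insert v U) - G.reducedBetti U)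
      * betaWeight (#S + 1) (#U + 1)
      ≤ (if U.Nonempty ∧ Disjoint U N then 1 else 0) * betaWeight (#S + 1) (#U + 1) :=
    fun U hU => mul_le_mul_of_nonneg_right (hle U hU) (hpos U hU).le
  refine ⟨Finset.sum_le_sum hle', ?_⟩
  rw [Finset.sum_eq_sum_iff_of_le hle']
  constructor
  · intro h a ha b hb hab
    by_contra hadj
    obtain ⟨haS, hva⟩ := (hN a).1 ha
    obtain ⟨hbS, hvb⟩ := (hN b).1 hb
    have hU : ({a, b} : Finset V) ∈ S.powerset := by
      simp [Finset.insert_subset_iff, haS, hbS]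
    have h0 := mul_right_cancel₀ (hpos _ hU).ne' (h _ hU)
    have hd : ¬ Disjoint ({a, b} : Finset V) N :=
      Finset.not_disjoint_iff.2 ⟨a, by simp, ha⟩
    rw [if_neg fun h => hd h.2, reducedBetti_insert_sub G ⟨a, by simp⟩, sub_eq_zero,
      Nat.cast_inj, Finset.coe_pair] at h0
    exact (G.card_component_insert_pair_lt hab hadj hva hvb).ne h0
  · intro h U hU
    have hU' := Finset.mem_powerset.1 hU
    congr 1
    by_cases hd : Disjoint U N
    · exact hdisj U hU hd
    · obtain ⟨a, ha, haN⟩ := Finset.not_disjoint_iff.1 hd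
      rw [if_neg fun h => hd h.2]
      refine G.reducedBetti_insert_sub_eq_zero (fun h => hv (hU' h)) ha ((hN a).1 haN).2 ?_
      intro b hb hvb
      by_cases hba : b = a
      · exact Or.inl hba
      · exact Or.inr (h (Finset.mem_coe.2 ((hN b).2 ⟨hU' hb, hvb⟩)) haN hba)

end SimpleGraph

/-- For a graph `G` on vertices `v₁ < ⋯ < vₙ` (here `Fin n` with its natural
ordering, the vertex `vᵢ` of the paper being `i : Fin n` zero-indexed, so `|{v₁,…,vᵢ}| = i+1`),
with `δ` the in-degree of `i` and `Gᵢ` the subgraph induced on the first `i` vertices: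
`τ₀(Gᵢ) − τ₀(G_{i−1}) ≤ 1/((δ+1)(δ+2)) − 1/(i(i+1))`, with equality iff the set of earlier
neighbors of `vᵢ` is a clique in `G`. -/
theorem tau0_peo_step {n : ℕ} (G : SimpleGraph (Fin n)) (i : Fin n)
    (δ : ℕ) (hδ : δ = Nat.card {j : Fin n // j < i ∧ G.Adj j i}) :
    tau0 (G.induce {j : Fin n | j ≤ i}) - tau0 (G.induce {j : Fin n | j < i})
        ≤ 1 / (((δ : ℚ) + 1) * ((δ : ℚ) + 2))
          - 1 / ((((i : ℕ) : ℚ) + 1) * (((i : ℕ) : ℚ) + 2)) ∧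
      (tau0 (G.induce {j : Fin n | j ≤ i}) - tau0 (G.induce {j : Fin n | j < i})
          = 1 / (((δ : ℚ) + 1) * ((δ : ℚ) + 2))
            - 1 / ((((i : ℕ) : ℚ) + 1) * (((i : ℕ) : ℚ) + 2))
        ↔ G.IsClique {j : Fin n | j < i ∧ G.Adj j i}) := by
  classical
  let S : Finset (Fin n) := Finset.Iio i
  let N : Finset (Fin n) := S.filter fun j => G.Adj i j
  have hi : i ∉ S := by simp [S]
  have hN : ∀ a, a ∈ N ↔ a ∈ S ∧ G.Adj i a := fun a => by simp [N]
  have hNset : (↑N : Set (Fin n)) = {j : Fin n | j < i ∧ G.Adj j i} := by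
    ext j
    simp [N, S, G.adj_comm]
  have hcardN : #N = δ := by
    rw [hδ, ← Set.ncard_coe_finset, hNset]
    rfl
  have hcardS : #S = i := by simp [S]
  have hle : (↑(insert i S) : Set (Fin n)) = {j : Fin n | j ≤ i} := by
    ext j
    simp [S, le_iff_eq_or_lt]
  have hlt : (↑S : Set (Fin n)) = {j : Fin n | j < i} := by
    ext j
    simp [S]
  have hw : ∀ m : ℕ, betaWeight (m + 1) 1 = 1 / (((m : ℚ) + 1) * ((m : ℚ) + 2)) := by
    intro m
    rw [betaWeight, Nat.choose_one_right, one_div]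
    push_cast
    ring_nf
  rw [G.tau0_induce hle, G.tau0_induce hlt, G.sum_insert_sub_sum_reducedBetti hi, ← hNset,
    ← hw δ, ← hw i, ← hcardN, ← hcardS]
  exact G.sum_reducedBetti_insert_sub_le hi hN
end

section
/- Let d ≥ 1 and let C be a strongly connected pure d-dimensional simplicial complex with f₀ vertices and f₁ edges, where f₁ < C(f₀,2). Let k be the largest integer with k ≤ f₀ and C(k,2) + (f₀−k)·d ≤ f₁, and set j = f₁ − C(k,2) − (f₀−k−1)·d. Then d+1 ≤ k ≤ f₀−1, d ≤ j ≤ k−1, and τ₀(C) ≤ 1/(f₀+1) − 1/(k+1) + 1/((j+1)(j+2)) + (f₀−k−1)/((d+1)(d+2)); that is, τ₀(C) is at most τ₀ of the Billera–Lee graph with parameters (f₀, f₁, d). -/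
open Finset

/-- The graph (1-skeleton) of a pure simplicial complex given by its family `F` of facets. -/
def complexGraph {V : Type*} (F : Finset (Finset V)) : SimpleGraph V :=
  SimpleGraph.fromRel (fun u v => ∃ S ∈ F, u ∈ S ∧ v ∈ S)

/-- The dual (adjacency) graph of a pure `d`-dimensional complex with facet family `F`. -/
def dualGraph {V : Type*} [DecidableEq V] (F : Finset (Finset V)) (d : ℕ) :
    SimpleGraph {S // S ∈ F} :=
  SimpleGraph.fromRel (fun S T => ((S : Finset V) ∩ (T : Finset V)).card = d)

section LocallyConstant

variable {V : Type*}

/-- The space of functions supported on `W` that are constant along the edges of `G` inside `W`. -/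
def locConst (G : SimpleGraph V) (W : Finset V) : Submodule ℚ (V → ℚ) where
  carrier := {f | (∀ x ∉ W, f x = 0) ∧ ∀ x ∈ W, ∀ y ∈ W, G.Adj x y → f x = f y}
  add_mem' := by
    rintro f g ⟨hf, hf'⟩ ⟨hg, hg'⟩
    refine ⟨fun x hx => by simp [hf x hx, hg x hx], fun x hx y hy h => ?_⟩
    simp [hf' x hx y hy h, hg' x hx y hy h]
  zero_mem' := by simp
  smul_mem' := by
    rintro c f ⟨hf, hf'⟩
    refine ⟨fun x hx => by simp [hf x hx], fun x hx y hy h => ?_⟩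
    simp [hf' x hx y hy h]

theorem mem_locConst {G : SimpleGraph V} {W : Finset V} {f : V → ℚ} :
    f ∈ locConst G W ↔
      (∀ x ∉ W, f x = 0) ∧ ∀ x ∈ W, ∀ y ∈ W, G.Adj x y → f x = f y := Iff.rfl

open Classical in
theorem finrank_locConst (G : SimpleGraph V) (W : Finset V) :
    Module.finrank ℚ (locConst G W) =
      Nat.card (G.induce (W : Set V)).ConnectedComponent := by
  let C := (G.induce (W : Set V)).ConnectedComponent
  let T : (C → ℚ) →ₗ[ℚ] (V → ℚ) :=
    { toFun := fun g x =>
        if h : x ∈ (W : Set V) then g ((G.induce (W : Set V)).connectedComponentMk ⟨x, h⟩) else 0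
      map_add' := by
        intro f g; ext x; by_cases h : x ∈ W <;> simp [h]
      map_smul' := by
        intro c g; ext x; by_cases h : x ∈ W <;> simp [h] }
  have hinj : Function.Injective T := by
    intro f g hfg
    ext c
    induction c using SimpleGraph.ConnectedComponent.ind with
    | h v =>
      obtain ⟨x, hx⟩ := v
      have := congrFun hfg x
      simpa [T, show x ∈ W from hx] using this
  have hrange : LinearMap.range T = locConst G W := by
    ext f
    rw [mem_locConst]
    constructor
    · rintro ⟨g, rfl⟩
      refine ⟨fun x hx => by simp [T, hx], fun x hx y hy h => ?_⟩
      have : (G.induce (W : Set V)).connectedComponentMk ⟨x, hx⟩ =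
          (G.induce (W : Set V)).connectedComponentMk ⟨y, hy⟩ :=
        SimpleGraph.ConnectedComponent.eq.mpr
          (SimpleGraph.Adj.reachable (by simpa using h))
      simp [T, hx, hy, this]
    · rintro ⟨h0, h1⟩
      refine ⟨SimpleGraph.ConnectedComponent.lift (fun x => f x) ?_, ?_⟩
      · intro x y p _
        induction p with
        | nil => rfl
        | cons h p ih =>
          refine (h1 _ (by simp) _ (by simp)
            (by simpa using h)).trans (ih ?_)
          simp_all [SimpleGraph.Walk.cons_isPath_iff]
      · ext x
        by_cases hx : x ∈ W
        · simp [T, hx]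
        · simp [T, hx, h0 x hx]
  have : Finite C := Quot.finite _
  have := Fintype.ofFinite C
  rw [← hrange, LinearMap.finrank_range_of_inj hinj, Module.finrank_fintype_fun_eq_card,
    Nat.card_eq_fintype_card]

theorem locConst_empty (G : SimpleGraph V) : locConst G ∅ = ⊥ := by
  ext f
  simp [mem_locConst, funext_iff]

/-- The number of components of `G[W]` is at most the number of vertices of `W` without an
`r`-smaller neighbour in `W`. -/
theorem finrank_locConst_le [Fintype V] [DecidableEq V] (G : SimpleGraph V) (W : Finset V)
    (r : V → ℕ) (B : V → Finset V)
    (hB : ∀ x y, y ∈ B x ↔ r y < r x ∧ G.Adj y x) :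
    Module.finrank ℚ (locConst G W) ≤ #{x ∈ W | Disjoint W (B x)} := by
  set S := {x ∈ W | Disjoint W (B x)} with hS
  let T : locConst G W →ₗ[ℚ] (S → ℚ) :=
    (LinearMap.funLeft ℚ ℚ (Subtype.val : S → V)).comp (locConst G W).subtype
  have hinj : Function.Injective T := by
    rw [← LinearMap.ker_eq_bot, LinearMap.ker_eq_bot']
    rintro ⟨f, hf⟩ h
    have hzero : ∀ x ∈ S, f x = 0 := fun x hx => congrFun h ⟨x, hx⟩
    have key : ∀ n x, r x = n → f x = 0 := by
      intro n
      induction n using Nat.strong_induction_on with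
      | _ n ih =>
        intro x hx
        by_cases hxW : x ∈ W
        · by_cases hd : Disjoint W (B x)
          · exact hzero x (by simp [hS, hxW, hd])
          · obtain ⟨y, hyW, hyB⟩ := Finset.not_disjoint_iff.mp hd
            obtain ⟨hlt, hadj⟩ := (hB x y).mp hyB
            rw [← hf.2 y hyW x hxW hadj]
            exact ih _ (hx ▸ hlt) y rfl
        · exact hf.1 x hxW
    ext x
    exact key _ x rfl
  simpa using LinearMap.finrank_le_finrank_of_injective hinj

end LocallyConstant

section BetaWeights

open scoped Nat

variable {V : Type*} [Fintype V] [DecidableEq V]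

theorem betaWeight_rec (a b : ℕ) :
    ((a ! * b ! : ℕ) : ℚ) / ((a + b + 1)! : ℕ) =
      (((a + 1)! * b ! : ℕ) : ℚ) / ((a + 1 + b + 1)! : ℕ) +
        ((a ! * (b + 1)! : ℕ) : ℚ) / ((a + (b + 1) + 1)! : ℕ) := by
  have h1 : a + 1 + b + 1 = (a + b + 1) + 1 := by ring
  have h2 : a + (b + 1) + 1 = (a + b + 1) + 1 := by ring
  have := Nat.factorial_ne_zero (a + b + 1)
  rw [h1, h2, Nat.factorial_succ (a + b + 1), Nat.factorial_succ a, Nat.factorial_succ b]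
  push_cast
  field_simp
  ring

theorem sum_betaWeight (A B : Finset V) (h : Disjoint A B) :
    ∑ W : Finset V with A ⊆ W ∧ Disjoint W B,
        ((Fintype.card V : ℚ) + 1)⁻¹ * ((Fintype.card V).choose #W : ℚ)⁻¹ =
      (((#A)! * (#B)! : ℕ) : ℚ) / ((#A + #B + 1)! : ℕ) := by
  induction hn : #(A ∪ B)ᶜ generalizing A B with
  | zero =>
    have hU : A ∪ B = univ := compl_eq_empty_iff _ |>.mp (card_eq_zero.mp hn)
    have hcard : #A + #B = Fintype.card V := by
      rw [← card_union_of_disjoint h, hU, card_univ]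
    have hfilter : ({W : Finset V | A ⊆ W ∧ Disjoint W B} : Finset (Finset V)) = {A} := by
      ext W
      simp only [mem_filter, mem_univ, true_and, mem_singleton]
      refine ⟨fun ⟨h1, h2⟩ => (h1.antisymm fun x hx => ?_).symm, ?_⟩
      · have : x ∈ A ∪ B := hU ▸ mem_univ x
        exact (mem_union.mp this).resolve_right (disjoint_left.mp h2 hx)
      · rintro rfl
        exact ⟨Subset.rfl, h⟩
    rw [hfilter, sum_singleton, ← hcard]
    have hc := Nat.add_choose_mul_factorial_mul_factorial (#A) (#B)
    have h0 : ((#A + #B).choose #A : ℚ) ≠ 0 := by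
      exact_mod_cast (Nat.choose_pos (Nat.le_add_right _ _)).ne'
    have ha := Nat.factorial_ne_zero (#A)
    have hb := Nat.factorial_ne_zero (#B)
    rw [Nat.factorial_succ, ← hc, ← Nat.choose_symm_add]
    push_cast
    field_simp
  | succ n ih =>
    obtain ⟨x, hx⟩ : ((A ∪ B)ᶜ).Nonempty := card_pos.mp (by omega)
    have hx' : x ∉ A ∧ x ∉ B := by simpa using hx
    have hA : #(insert x A) = #A + 1 := card_insert_of_notMem hx'.1
    have hB : #(insert x B) = #B + 1 := card_insert_of_notMem hx'.2
    have e1 : (insert x A ∪ B)ᶜ = (A ∪ B)ᶜ.erase x := by ext; simp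
    have e2 : (A ∪ insert x B)ᶜ = (A ∪ B)ᶜ.erase x := by ext; simp
    have i1 := ih (insert x A) B (by simp [h, hx'.2])
      (by rw [e1, card_erase_of_mem hx, hn]; rfl)
    have i2 := ih A (insert x B) (by simp [h, hx'.1])
      (by rw [e2, card_erase_of_mem hx, hn]; rfl)
    rw [hA] at i1
    rw [hB] at i2
    rw [betaWeight_rec, ← i1, ← i2, ← sum_filter_add_sum_filter_not _ (fun W => x ∈ W),
      filter_filter, filter_filter]
    congr 2 <;> ext W <;> simp [insert_subset_iff] <;> tauto

end BetaWeights

section TauBounds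

open scoped Nat

variable {V : Type*} [Fintype V]

open Classical in
theorem tau0_eq_sum_finrank (G : SimpleGraph V) :
    tau0 G = ∑ W : Finset V, ((Fintype.card V : ℚ) + 1)⁻¹ * ((Fintype.card V).choose #W : ℚ)⁻¹ *
        (Module.finrank ℚ (locConst G W) : ℚ)
      - (1 - ((Fintype.card V : ℚ) + 1)⁻¹) := by
  have htot := sum_betaWeight (∅ : Finset V) ∅ (by simp)
  simp only [empty_subset, disjoint_empty_right, and_self, filter_true, card_empty] at htot
  have hrest : ∑ W : Finset V, (if W.Nonempty then
      ((Fintype.card V : ℚ) + 1)⁻¹ * ((Fintype.card V).choose #W : ℚ)⁻¹ else 0) =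
      1 - ((Fintype.card V : ℚ) + 1)⁻¹ := by
    rw [eq_sub_iff_add_eq]
    refine Eq.trans ?_ (htot.trans (by simp))
    rw [← Finset.sum_erase_add _ _ (mem_univ (∅ : Finset V)),
      ← Finset.sum_erase_add (a := (∅ : Finset V)) univ
        (fun W => ((Fintype.card V : ℚ) + 1)⁻¹ * ((Fintype.card V).choose #W : ℚ)⁻¹) (mem_univ _)]
    simp only [Finset.not_nonempty_empty, if_false, add_zero, card_empty, Nat.choose_zero_right,
      Nat.cast_one, inv_one, mul_one]
    congr 1
    refine sum_congr rfl fun W hW => ?_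
    rw [if_pos (nonempty_iff_ne_empty.mpr (ne_of_mem_erase hW))]
  rw [← hrest, ← sum_sub_distrib, tau0, mul_sum]
  refine sum_congr rfl fun W _ => ?_
  split_ifs with hW
  · rw [finrank_locConst]
    ring
  · rw [not_nonempty_iff_eq_empty] at hW
    subst hW
    simp [locConst_empty]

/-- An elimination order bounds `τ₀` through the numbers of earlier neighbours. -/
theorem tau0_le_of_order [DecidableEq V] (G : SimpleGraph V)
    (r : V → ℕ) (B : V → Finset V)
    (hB : ∀ x y, y ∈ B x ↔ r y < r x ∧ G.Adj y x) :
    tau0 G ≤ ∑ x, 1 / (((#(B x) : ℚ) + 1) * ((#(B x) : ℚ) + 2))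
      - (1 - ((Fintype.card V : ℚ) + 1)⁻¹) := by
  rw [tau0_eq_sum_finrank]
  gcongr
  set w : Finset V → ℚ := fun W =>
    ((Fintype.card V : ℚ) + 1)⁻¹ * ((Fintype.card V).choose #W : ℚ)⁻¹ with hw
  have hw0 : ∀ W, 0 ≤ w W := fun W => by positivity
  calc ∑ W, w W * (Module.finrank ℚ (locConst G W) : ℚ)
      ≤ ∑ W, w W * (#{x ∈ W | Disjoint W (B x)} : ℚ) := by
        refine sum_le_sum fun W _ => mul_le_mul_of_nonneg_left ?_ (hw0 W)
        exact_mod_cast finrank_locConst_le G W r B hB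
    _ = ∑ W, ∑ x, if {x} ⊆ W ∧ Disjoint W (B x) then w W else 0 := by
        refine sum_congr rfl fun W _ => ?_
        rw [← sum_filter, sum_const, nsmul_eq_mul, mul_comm]
        congr 3
        ext x
        simp
    _ = ∑ x, 1 / (((#(B x) : ℚ) + 1) * ((#(B x) : ℚ) + 2)) := by
        rw [sum_comm]
        refine sum_congr rfl fun x _ => ?_
        have hd : Disjoint {x} (B x) := by
          rw [disjoint_singleton_left, hB]
          exact fun h => lt_irrefl _ h.1
        rw [← sum_filter, sum_betaWeight _ _ hd]
        have := Nat.factorial_ne_zero #(B x)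
        rw [card_singleton, show 1 + #(B x) + 1 = #(B x) + 1 + 1 by ring,
          Nat.factorial_succ (#(B x) + 1), Nat.factorial_succ #(B x), Nat.factorial_one]
        push_cast
        field_simp
        ring

end TauBounds

section Compression

variable {V : Type*} [DecidableEq V]

/-- The compression of `G` towards `u` from `v`: the edges from `v` to vertices not adjacent to
`u` (and different from `u`) are moved to `u`. -/
def compression (G : SimpleGraph V) (u v : V) : SimpleGraph V where
  Adj x y :=
    (G.Adj x y ∧ (G.Adj (Equiv.swap u v x) (Equiv.swap u v y) ∨ x ≠ v ∧ y ≠ v)) ∨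
      G.Adj (Equiv.swap u v x) (Equiv.swap u v y) ∧ (x = u ∨ y = u)
  symm := ⟨fun x y h => by simpa [G.adj_comm, and_comm, or_comm] using h⟩
  loopless := ⟨fun x h => by simp at h⟩

variable {G : SimpleGraph V} {u v x y : V}

theorem compression_adj_left (hu : x ≠ u) (hv : x ≠ v) (huv : u ≠ v) :
    (compression G u v).Adj u x ↔ G.Adj u x ∨ G.Adj v x := by
  simp [compression, Equiv.swap_apply_of_ne_of_ne hu hv, huv, hv]

theorem compression_adj_right (hu : x ≠ u) (hv : x ≠ v) (huv : u ≠ v) :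
    (compression G u v).Adj v x ↔ G.Adj u x ∧ G.Adj v x := by
  simp [compression, Equiv.swap_apply_of_ne_of_ne hu hv, huv.symm, hu]
  tauto

theorem compression_adj_pair (huv : u ≠ v) : (compression G u v).Adj u v ↔ G.Adj u v := by
  simp [compression, huv, G.adj_comm]

theorem compression_adj_of_ne (hxu : x ≠ u) (hxv : x ≠ v) (hyu : y ≠ u) (hyv : y ≠ v) :
    (compression G u v).Adj x y ↔ G.Adj x y := by
  simp [compression, hxu, hxv, hyu, hyv]

theorem compression_adj_of_ne_right (hxv : x ≠ v) (hyv : y ≠ v) :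
    (compression G u v).Adj x y ↔
      G.Adj x y ∨ (x = u ∨ y = u) ∧ G.Adj (Equiv.swap u v x) (Equiv.swap u v y) := by
  simp [compression, hxv, hyv]
  tauto

variable (G u v)

/-- The exchange of `u` and `v` in sets of vertices. -/
def swapSet (W : Finset V) : Finset V := W.map (Equiv.swap u v).toEmbedding

variable {u v}

@[simp] theorem mem_swapSet {W : Finset V} : x ∈ swapSet u v W ↔ Equiv.swap u v x ∈ W := by
  simp [swapSet, Finset.mem_map_equiv]

theorem swapSet_involutive : Function.Involutive (swapSet u v) := fun W => by ext; simp

theorem card_swapSet (W : Finset V) : #(swapSet u v W) = #W := card_map _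

theorem swapSet_eq_self_iff {W : Finset V} (h : u ∈ W ↔ v ∈ W) : swapSet u v W = W := by
  ext x
  rw [mem_swapSet]
  rcases eq_or_ne x u with rfl | hu
  · simpa using h.symm
  rcases eq_or_ne x v with rfl | hv
  · simpa using h
  rw [Equiv.swap_apply_of_ne_of_ne hu hv]

theorem finrank_locConst_swapSet (W : Finset V) :
    Module.finrank ℚ (locConst G (swapSet u v W)) =
      Module.finrank ℚ (locConst (G.comap (Equiv.swap u v)) W) := by
  have h : (locConst G (swapSet u v W)).map
      (LinearEquiv.funCongrLeft ℚ ℚ (Equiv.swap u v)).toLinearMap =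
        locConst (G.comap (Equiv.swap u v)) W := by
    ext f
    constructor
    · rintro ⟨g, ⟨h0, h1⟩, rfl⟩
      exact ⟨fun x hx => h0 _ (by simpa using hx),
        fun x hx y hy h => h1 _ (by simpa using hx) _ (by simpa using hy) h⟩
    · rintro ⟨h0, h1⟩
      refine ⟨f ∘ Equiv.swap u v, ⟨fun x hx => h0 _ (by simpa using hx),
        fun x hx y hy h => h1 _ (by simpa using hx) _ (by simpa using hy) (by simpa using h)⟩, ?_⟩
      ext x
      simp [LinearEquiv.funCongrLeft]
  rw [← h, LinearEquiv.finrank_map_eq]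

variable [Fintype V]

theorem finrank_add_le_of_mem {W : Finset V} (hu : u ∈ W) (hv : v ∉ W) :
    Module.finrank ℚ (locConst G W) + Module.finrank ℚ (locConst G (swapSet u v W)) ≤
      Module.finrank ℚ (locConst (compression G u v) W) +
        Module.finrank ℚ (locConst (compression G u v) (swapSet u v W)) := by
  have huv : u ≠ v := fun h => hv (h ▸ hu)
  rw [finrank_locConst_swapSet, finrank_locConst_swapSet,
    ← Submodule.finrank_sup_add_finrank_inf_eq, add_comm]
  refine add_le_add (Submodule.finrank_mono ?_) (Submodule.finrank_mono (sup_le ?_ ?_))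
  · rintro f ⟨⟨h0, h1⟩, -, h2⟩
    refine ⟨h0, fun x hx y hy h => ?_⟩
    rw [compression_adj_of_ne_right (ne_of_mem_of_not_mem hx hv) (ne_of_mem_of_not_mem hy hv)] at h
    rcases h with h | ⟨-, h⟩
    · exact h1 x hx y hy h
    · exact h2 x hx y hy h
  all_goals
    rintro f ⟨h0, h1⟩
    refine ⟨h0, fun x hx y hy h => h1 x hx y hy ?_⟩
    have hxv : x ≠ v := fun h => hv (h ▸ hx)
    have hyv : y ≠ v := fun h => hv (h ▸ hy)
    rw [SimpleGraph.comap_adj] at h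
    by_cases hxu : x = u <;> by_cases hyu : y = u
    · simp [hxu, hyu] at h
    · rw [hxu, Equiv.swap_apply_left, Equiv.swap_apply_of_ne_of_ne hyu hyv,
        compression_adj_right hyu hyv huv] at h
      simp [hxu, Equiv.swap_apply_of_ne_of_ne hyu hyv, h]
    · rw [hyu, Equiv.swap_apply_left, Equiv.swap_apply_of_ne_of_ne hxu hxv,
        SimpleGraph.adj_comm, compression_adj_right hxu hxv huv] at h
      simp [hyu, Equiv.swap_apply_of_ne_of_ne hxu hxv, G.adj_comm x, h]
    · rw [Equiv.swap_apply_of_ne_of_ne hyu hyv, Equiv.swap_apply_of_ne_of_ne hxu hxv,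
        compression_adj_of_ne hxu hxv hyu hyv] at h
      simp [Equiv.swap_apply_of_ne_of_ne hxu hxv, Equiv.swap_apply_of_ne_of_ne hyu hyv, h]

theorem finrank_le_of_mem_mem {W : Finset V} (huv : u ≠ v) (hu : u ∈ W) (hv : v ∈ W) :
    Module.finrank ℚ (locConst G W) ≤ Module.finrank ℚ (locConst (compression G u v) W) := by
  have key : ∀ f ∈ locConst G W, f u = f v → f ∈ locConst (compression G u v) W := by
    rintro f ⟨h0, h1⟩ hf
    refine ⟨h0, ?_⟩
    have main : ∀ x ∈ W, ∀ y ∈ W, y ≠ u → y ≠ v → (compression G u v).Adj x y → f x = f y := by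
      intro x hx y hy hyu hyv h
      rcases eq_or_ne x u with rfl | hxu
      · rcases (compression_adj_left hyu hyv huv).mp h with h | h
        · exact h1 _ hx _ hy h
        · exact hf.trans (h1 _ hv _ hy h)
      · rcases eq_or_ne x v with rfl | hxv
        · exact h1 _ hx _ hy ((compression_adj_right hyu hyv huv).mp h).2
        · exact h1 _ hx _ hy ((compression_adj_of_ne hxu hxv hyu hyv).mp h)
    intro x hx y hy h
    by_cases hyuv : y = u ∨ y = v
    · by_cases hxuv : x = u ∨ x = v
      · rcases hyuv with rfl | rfl <;> rcases hxuv with rfl | rfl <;> simp [hf]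
      · push Not at hxuv
        exact (main y hy x hx hxuv.1 hxuv.2 h.symm).symm
    · push Not at hyuv
      exact main x hx y hy hyuv.1 hyuv.2 h
  by_cases hc : G.Adj u v ∨ ∃ z ∈ W, z ≠ u ∧ z ≠ v ∧ G.Adj u z ∧ G.Adj v z
  · refine Submodule.finrank_mono fun f hf => key f hf ?_
    rcases hc with hc | ⟨z, hz, -, -, h1, h2⟩
    · exact hf.2 u hu v hv hc
    · exact (hf.2 u hu z hz h1).trans (hf.2 v hv z hz h2).symm
  · push Not at hc
    let δ : (V → ℚ) →ₗ[ℚ] ℚ := (LinearMap.proj u : (V → ℚ) →ₗ[ℚ] ℚ) - LinearMap.proj v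
    set K := LinearMap.ker δ with hK
    have hδ : ∀ f, δ f = f u - f v := fun f => rfl
    have hsingle : Pi.single v (1 : ℚ) ∈ locConst (compression G u v) W := by
      have : ∀ y ∈ W, ¬ (compression G u v).Adj v y := by
        intro y hy h
        rcases eq_or_ne y u with rfl | hyu
        · exact hc.1 ((compression_adj_pair huv).mp h.symm)
        · have hyv : y ≠ v := h.ne'
          obtain ⟨h1, h2⟩ := (compression_adj_right hyu hyv huv).mp h
          exact hc.2 y hy hyu hyv h1 h2
      refine ⟨fun x hx => ?_, fun x hx y hy h => ?_⟩
      · exact Pi.single_eq_of_ne (ne_of_mem_of_not_mem hv hx).symm _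
      · rw [Pi.single_eq_of_ne, Pi.single_eq_of_ne]
        · rintro rfl; exact this x hx h.symm
        · rintro rfl; exact this y hy h
    have htop : locConst (compression G u v) W ⊔ K = ⊤ := by
      rw [eq_top_iff]
      intro g _
      refine Submodule.mem_sup.mpr ⟨(g v - g u) • Pi.single v 1,
        Submodule.smul_mem _ _ hsingle, g - (g v - g u) • Pi.single v 1, ?_, by simp⟩
      rw [hK, LinearMap.mem_ker, hδ]
      simp [huv]
    have e1 := Submodule.finrank_sup_add_finrank_inf_eq (locConst G W) K
    have e2 := Submodule.finrank_sup_add_finrank_inf_eq (locConst (compression G u v) W) K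
    have l1 : Module.finrank ℚ ↥(locConst G W ⊔ K) ≤
        Module.finrank ℚ ↥(locConst (compression G u v) W ⊔ K) :=
      Submodule.finrank_mono (htop ▸ le_top)
    have l2 : Module.finrank ℚ ↥(locConst G W ⊓ K) ≤
        Module.finrank ℚ ↥(locConst (compression G u v) W ⊓ K) := by
      refine Submodule.finrank_mono ?_
      rintro f ⟨hf, hf'⟩
      exact ⟨key f hf (sub_eq_zero.mp hf'), hf'⟩
    omega

theorem finrank_add_le (huv : u ≠ v) (W : Finset V) :
    Module.finrank ℚ (locConst G W) + Module.finrank ℚ (locConst G (swapSet u v W)) ≤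
      Module.finrank ℚ (locConst (compression G u v) W) +
        Module.finrank ℚ (locConst (compression G u v) (swapSet u v W)) := by
  by_cases hu : u ∈ W <;> by_cases hv : v ∈ W
  · rw [swapSet_eq_self_iff (by simp [hu, hv])]
    have := finrank_le_of_mem_mem G huv hu hv
    omega
  · exact finrank_add_le_of_mem G hu hv
  · have := finrank_add_le_of_mem G (u := u) (v := v) (W := swapSet u v W)
      (by simpa using hv) (by simpa using hu)
    rw [swapSet_involutive] at this
    omega
  · rw [swapSet_eq_self_iff (by simp [hu, hv])]
    have : Module.finrank ℚ (locConst G W) ≤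
        Module.finrank ℚ (locConst (compression G u v) W) := by
      refine Submodule.finrank_mono fun f hf => ⟨hf.1, fun x hx y hy h => hf.2 x hx y hy ?_⟩
      exact (compression_adj_of_ne (ne_of_mem_of_not_mem hx hu) (ne_of_mem_of_not_mem hx hv)
        (ne_of_mem_of_not_mem hy hu) (ne_of_mem_of_not_mem hy hv)).mp h
    omega

theorem tau0_le_tau0_compression (huv : u ≠ v) : tau0 G ≤ tau0 (compression G u v) := by
  rw [tau0_eq_sum_finrank, tau0_eq_sum_finrank]
  gcongr ?_ - _
  set w : ℕ → ℚ := fun m =>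
    ((Fintype.card V : ℚ) + 1)⁻¹ * ((Fintype.card V).choose m : ℚ)⁻¹ with hw
  have hw0 : ∀ m, 0 ≤ w m := fun m => by positivity
  have hswap : ∀ H : SimpleGraph V,
      ∑ W : Finset V, w #W * (Module.finrank ℚ (locConst H (swapSet u v W)) : ℚ) =
        ∑ W : Finset V, w #W * (Module.finrank ℚ (locConst H W) : ℚ) := by
    intro H
    refine Fintype.sum_equiv (swapSet_involutive (u := u) (v := v)).toPerm _ _ fun W => ?_
    rw [Function.Involutive.coe_toPerm, card_swapSet]
  have hsum : ∑ W : Finset V, w #W * ((Module.finrank ℚ (locConst G W) : ℚ) +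
        Module.finrank ℚ (locConst G (swapSet u v W))) ≤
      ∑ W : Finset V, w #W * ((Module.finrank ℚ (locConst (compression G u v) W) : ℚ) +
        Module.finrank ℚ (locConst (compression G u v) (swapSet u v W))) := by
    refine sum_le_sum fun W _ => mul_le_mul_of_nonneg_left ?_ (hw0 _)
    exact_mod_cast finrank_add_le G huv W
  simp only [mul_add, sum_add_distrib, hswap] at hsum
  linarith

end Compression

section DegreeSums

variable {V : Type*} [Fintype V] [DecidableEq V] {G : SimpleGraph V} {u v x : V}

open Classical in
theorem degree_eq_of_ne (H : SimpleGraph V) (x : V) (huv : u ≠ v) :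
    H.degree x = (if H.Adj x u then 1 else 0) + (if H.Adj x v then 1 else 0) +
      #{y | y ≠ u ∧ y ≠ v ∧ H.Adj x y} := by
  have h : ({y | y ≠ u ∧ y ≠ v ∧ H.Adj x y} : Finset V) =
      {y ∈ (univ.erase u).erase v | H.Adj x y} := by
    ext y; simp; tauto
  rw [h, card_filter, ← SimpleGraph.card_neighborFinset_eq_degree,
    SimpleGraph.neighborFinset_eq_filter, card_filter,
    ← add_sum_erase univ _ (mem_univ u),
    ← add_sum_erase (univ.erase u) _ (mem_erase.mpr ⟨huv.symm, mem_univ v⟩), add_assoc]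

open Classical in
theorem degree_compression_of_ne (huv : u ≠ v) (hxu : x ≠ u) (hxv : x ≠ v) :
    (compression G u v).degree x = G.degree x := by
  have h : ({y | y ≠ u ∧ y ≠ v ∧ (compression G u v).Adj x y} : Finset V) =
      ({y | y ≠ u ∧ y ≠ v ∧ G.Adj x y} : Finset V) := by
    ext y
    simp only [mem_filter, mem_univ, true_and]
    refine and_congr_right fun hyu => and_congr_right fun hyv => ?_
    exact compression_adj_of_ne hxu hxv hyu hyv
  rw [degree_eq_of_ne _ x huv, degree_eq_of_ne G x huv, h]
  simp only [SimpleGraph.adj_comm _ x u, SimpleGraph.adj_comm _ x v,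
    compression_adj_left hxu hxv huv, compression_adj_right hxu hxv huv]
  by_cases h1 : G.Adj u x <;> by_cases h2 : G.Adj v x <;> simp [h1, h2]

open Classical in
/-- The degrees of `u` and `v` before and after compression, in terms of their neighbourhoods
`P` and `Q` away from `u` and `v`. -/
theorem degree_compression_pair (huv : u ≠ v) :
    ∃ (e : ℕ) (P Q : Finset V), (∀ y, y ∈ P ↔ y ≠ u ∧ y ≠ v ∧ G.Adj u y) ∧
      (∀ y, y ∈ Q ↔ y ≠ u ∧ y ≠ v ∧ G.Adj v y) ∧
      G.degree u = e + #P ∧ G.degree v = e + #Q ∧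
      (compression G u v).degree u = e + #(P ∪ Q) ∧
      (compression G u v).degree v = e + #(P ∩ Q) := by
  set P : Finset V := {y | y ≠ u ∧ y ≠ v ∧ G.Adj u y} with hP
  set Q : Finset V := {y | y ≠ u ∧ y ≠ v ∧ G.Adj v y} with hQ
  have hU : ({y | y ≠ u ∧ y ≠ v ∧ (compression G u v).Adj u y} : Finset V) = P ∪ Q := by
    ext y
    simp only [hP, hQ, mem_filter, mem_univ, true_and, mem_union]
    by_cases hyu : y = u <;> by_cases hyv : y = v <;>
      simp [hyu, hyv, compression_adj_left, huv]
  have hI : ({y | y ≠ u ∧ y ≠ v ∧ (compression G u v).Adj v y} : Finset V) = P ∩ Q := by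
    ext y
    simp only [hP, hQ, mem_filter, mem_univ, true_and, mem_inter]
    by_cases hyu : y = u <;> by_cases hyv : y = v <;>
      simp [hyu, hyv, compression_adj_right, huv]
  refine ⟨if G.Adj u v then 1 else 0, P, Q, by simp [hP], by simp [hQ], ?_⟩
  rw [degree_eq_of_ne G u huv, degree_eq_of_ne G v huv, degree_eq_of_ne _ u huv,
    degree_eq_of_ne _ v huv, hU, hI, ← hP, ← hQ]
  simp [SimpleGraph.adj_comm _ v u, compression_adj_pair huv]

open Classical in
theorem sum_degree_eq_of_ne (f : ℕ → ℕ) (H : SimpleGraph V) (huv : u ≠ v) :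
    ∑ x, f (H.degree x) = f (H.degree u) + f (H.degree v) +
      ∑ x ∈ (univ.erase u).erase v, f (H.degree x) := by
  rw [← add_sum_erase univ _ (mem_univ u),
    ← add_sum_erase (univ.erase u) _ (mem_erase.mpr ⟨huv.symm, mem_univ v⟩), add_assoc]

open Classical in
theorem sum_degree_compression_rest (f : ℕ → ℕ) (huv : u ≠ v) :
    ∑ x ∈ (univ.erase u).erase v, f ((compression G u v).degree x) =
      ∑ x ∈ (univ.erase u).erase v, f (G.degree x) := by
  refine sum_congr rfl fun x hx => ?_
  rw [mem_erase, mem_erase] at hx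
  rw [degree_compression_of_ne huv hx.2.1 hx.1]

open Classical in
theorem sum_degree_compression (huv : u ≠ v) :
    ∑ x, (compression G u v).degree x = ∑ x, G.degree x := by
  have h1 := sum_degree_eq_of_ne id (compression G u v) huv
  have h2 := sum_degree_eq_of_ne id G huv
  rw [sum_degree_compression_rest id huv] at h1
  obtain ⟨e, P, Q, -, -, e1, e2, e3, e4⟩ := degree_compression_pair (G := G) huv
  have hcard := card_union_add_card_inter P Q
  simp only [id] at h1 h2
  omega

/-- Away from `u` and `v`, the neighbourhoods of `u` and `v` are comparable. -/
def NestedAt (G : SimpleGraph V) (u v : V) : Prop :=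
  (∀ w, w ≠ v → G.Adj u w → G.Adj v w) ∨ ∀ w, w ≠ u → G.Adj v w → G.Adj u w

open Classical in
theorem sum_degree_sq_lt (huv : u ≠ v) (h : ¬ NestedAt G u v) :
    ∑ x, G.degree x ^ 2 < ∑ x, (compression G u v).degree x ^ 2 := by
  rw [NestedAt, not_or] at h
  push Not at h
  obtain ⟨⟨w, hwv, huw, hvw⟩, w', hw'u, hvw', huw'⟩ := h
  have h1 := sum_degree_eq_of_ne (· ^ 2) (compression G u v) huv
  have h2 := sum_degree_eq_of_ne (· ^ 2) G huv
  rw [sum_degree_compression_rest (· ^ 2) huv] at h1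
  obtain ⟨e, P, Q, hP, hQ, e1, e2, e3, e4⟩ := degree_compression_pair (G := G) huv
  have hwP : w ∈ P := (hP w).mpr ⟨huw.ne', hwv, huw⟩
  have hwQ : w ∉ Q := fun h => hvw ((hQ w).mp h).2.2
  have hwQ' : w' ∈ Q := (hQ w').mpr ⟨hw'u, hvw'.ne', hvw'⟩
  have hwP' : w' ∉ P := fun h => huw' ((hP w').mp h).2.2
  have l1 : #(P ∩ Q) < #P :=
    card_lt_card ⟨inter_subset_left, fun h => hwQ (mem_inter.mp (h hwP)).2⟩
  have l2 : #(P ∩ Q) < #Q :=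
    card_lt_card ⟨inter_subset_right, fun h => hwP' (mem_inter.mp (h hwQ')).1⟩
  have hcard := card_union_add_card_inter P Q
  obtain ⟨a, ha⟩ := Nat.exists_eq_add_of_lt l1
  obtain ⟨b, hb⟩ := Nat.exists_eq_add_of_lt l2
  have hU : #(P ∪ Q) = #(P ∩ Q) + (a + 1) + (b + 1) := by omega
  rw [h1, h2, e1, e2, e3, e4, hU, ha, hb]
  nlinarith [Nat.zero_le (a * b)]

end DegreeSums

section FacetSystems

variable {V : Type*} [DecidableEq V]

/-- `F` is a strongly connected family of `(d + 1)`-cliques of `G` that covers the vertices. -/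
structure IsFacetSystem (G : SimpleGraph V) (d : ℕ) (F : Set (Finset V)) : Prop where
  card : ∀ S ∈ F, #S = d + 1
  clique : ∀ S ∈ F, ∀ x ∈ S, ∀ y ∈ S, x ≠ y → G.Adj x y
  cover : ∀ x, ∃ S ∈ F, x ∈ S
  connected : ∀ S ∈ F, ∀ T ∈ F,
    Relation.ReflTransGen (fun A B => B ∈ F ∧ d ≤ #(A ∩ B)) S T

variable {G : SimpleGraph V} {d : ℕ} {F : Set (Finset V)} {u v : V}

theorem IsFacetSystem.insert (hF : IsFacetSystem G d F) {S T : Finset V} (hS : S ∈ F)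
    (hTcard : #T = d + 1) (hT : ∀ x ∈ T, ∀ y ∈ T, x ≠ y → G.Adj x y) (hST : d ≤ #(S ∩ T)) :
    IsFacetSystem G d (Insert.insert T F) where
  card := by
    rintro A (rfl | hA)
    exacts [hTcard, hF.card A hA]
  clique := by
    rintro A (rfl | hA)
    exacts [hT, hF.clique A hA]
  cover x := by
    obtain ⟨A, hA, hx⟩ := hF.cover x
    exact ⟨A, Or.inr hA, hx⟩
  connected := by
    have old : ∀ A ∈ F, ∀ B ∈ F, Relation.ReflTransGen
        (fun A B => B ∈ Insert.insert T F ∧ d ≤ #(A ∩ B)) A B := fun A hA B hB =>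
      (hF.connected A hA B hB).lift id fun _ _ h => ⟨Or.inr h.1, h.2⟩
    rintro A (rfl | hA) B (rfl | hB)
    · rfl
    · exact (old S hS B hB).head ⟨Or.inr hS, inter_comm S A ▸ hST⟩
    · exact (old A hA S hS).tail ⟨Or.inl rfl, hST⟩
    · exact old A hA B hB

/-- The effect on a set of replacing `v` by `u`, when `v` but not `u` belongs to it. -/
def shiftSet (u v : V) (S : Finset V) : Finset V :=
  if v ∈ S ∧ u ∉ S then Insert.insert u (S.erase v) else S

theorem card_shiftSet (S : Finset V) : #(shiftSet u v S) = #S := by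
  rw [shiftSet]
  split_ifs with h
  · rw [card_insert_of_notMem (by simp [h.2]), card_erase_add_one h.1]
  · rfl

theorem card_inter_le_card_shiftSet_inter (A B : Finset V) :
    #(A ∩ B) ≤ #(shiftSet u v A ∩ shiftSet u v B) := by
  by_cases h : v ∈ A ∩ B ∧ u ∉ A ∩ B
  · rw [← card_shiftSet (u := u) (v := v) (A ∩ B)]
    refine card_le_card fun x hx => ?_
    unfold shiftSet at *
    grind
  · refine card_le_card fun x hx => ?_
    unfold shiftSet
    grind

theorem shiftSet_clique (huv : u ≠ v) {S : Finset V}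
    (hS : ∀ x ∈ S, ∀ y ∈ S, x ≠ y → G.Adj x y) :
    ∀ x ∈ shiftSet u v S, ∀ y ∈ shiftSet u v S, x ≠ y → (compression G u v).Adj x y := by
  have hpair : u ∈ shiftSet u v S → v ∈ shiftSet u v S → G.Adj u v := by
    intro hu hv
    unfold shiftSet at *
    grind
  have main : ∀ x ∈ shiftSet u v S, ∀ y ∈ shiftSet u v S, y ≠ u → y ≠ v → x ≠ y →
      (compression G u v).Adj x y := by
    intro x hx y hy hyu hyv hxy
    by_cases hxu : x = u
    · subst hxu
      rw [compression_adj_left hyu hyv huv]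
      unfold shiftSet at *
      grind
    · by_cases hxv : x = v
      · subst hxv
        rw [compression_adj_right hyu hyv huv]
        unfold shiftSet at *
        grind
      · rw [compression_adj_of_ne hxu hxv hyu hyv]
        unfold shiftSet at *
        grind
  intro x hx y hy hxy
  by_cases hy' : y = u ∨ y = v
  · by_cases hx' : x = u ∨ x = v
    · have := compression_adj_pair (G := G) huv
      rcases hx' with rfl | rfl <;> rcases hy' with rfl | rfl
      · exact absurd rfl hxy
      · exact this.mpr (hpair hx hy)
      · exact (this.mpr (hpair hy hx)).symm
      · exact absurd rfl hxy
    · push Not at hx'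
      exact (main y hy x hx hx'.1 hx'.2 hxy.symm).symm
  · push Not at hy'
    exact main x hx y hy hy'.1 hy'.2 hxy

theorem IsFacetSystem.compression (hF : IsFacetSystem G d F) (huv : u ≠ v) {K : Finset V}
    (hK : K ∈ F) (hu : u ∈ K) (hv : v ∈ K) :
    IsFacetSystem (compression G u v) d (Set.image (shiftSet u v) F) where
  card := by
    rintro _ ⟨S, hS, rfl⟩
    rw [card_shiftSet, hF.card S hS]
  clique := by
    rintro _ ⟨S, hS, rfl⟩
    exact shiftSet_clique huv (hF.clique S hS)
  cover x := by
    by_cases hx : x = v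
    · exact ⟨_, ⟨K, hK, rfl⟩, by simp [shiftSet, hu, hv, hx]⟩
    · obtain ⟨S, hS, hxS⟩ := hF.cover x
      refine ⟨_, ⟨S, hS, rfl⟩, ?_⟩
      unfold shiftSet
      grind
  connected := by
    rintro _ ⟨S, hS, rfl⟩ _ ⟨T, hT, rfl⟩
    exact (hF.connected S hS T hT).lift (shiftSet u v) fun A B h =>
      ⟨⟨B, h.1, rfl⟩, h.2.trans (card_inter_le_card_shiftSet_inter A B)⟩

/-- A set of `d` dominating vertices gives a facet system. -/
theorem isFacetSystem_of_dominating [Fintype V] {D : Finset V} (hcard : d < Fintype.card V)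
    (hDcard : #D = d) (hD : ∀ x ∈ D, ∀ y, y ≠ x → G.Adj x y) :
    ∃ F, IsFacetSystem G d F := by
  refine ⟨{S | ∃ x ∉ D, S = Insert.insert x D}, ?_, ?_, ?_, ?_⟩
  · rintro _ ⟨x, hx, rfl⟩
    rw [card_insert_of_notMem hx, hDcard]
  · rintro _ ⟨x, hx, rfl⟩ y hy z hz hyz
    rcases mem_insert.mp hy with rfl | hy
    · exact (hD z (mem_of_mem_insert_of_ne hz hyz.symm) y hyz).symm
    · exact hD y hy z hyz.symm
  · intro x
    by_cases hx : x ∈ D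
    · obtain ⟨y, hy⟩ : ∃ y, y ∉ D := by
        by_contra! h
        rw [← card_univ, ← eq_univ_iff_forall.mpr h, hDcard] at hcard
        exact lt_irrefl _ hcard
      exact ⟨_, ⟨y, hy, rfl⟩, mem_insert_of_mem hx⟩
    · exact ⟨_, ⟨x, hx, rfl⟩, mem_insert_self x D⟩
  · rintro _ ⟨x, hx, rfl⟩ _ ⟨y, hy, rfl⟩
    refine Relation.ReflTransGen.single ⟨⟨y, hy, rfl⟩, ?_⟩
    rw [← hDcard]
    exact card_le_card (subset_inter (subset_insert _ _) (subset_insert _ _))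

variable [Fintype V]

open Classical in
theorem degree_lt_of_nestedAt {w : V} (hn : NestedAt G u v) (hwu : w ≠ u) (hvw : G.Adj v w)
    (huw : ¬ G.Adj u w) : G.degree u < G.degree v := by
  have huv : u ≠ v := fun h => huw (h ▸ hvw)
  have h := hn.resolve_right fun h => huw (h w hwu hvw)
  rw [degree_eq_of_ne G u huv, degree_eq_of_ne G v huv]
  have hlt : #{y | y ≠ u ∧ y ≠ v ∧ G.Adj u y} < #{y | y ≠ u ∧ y ≠ v ∧ G.Adj v y} := by
    refine card_lt_card ⟨fun y hy => ?_, fun hs => huw ?_⟩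
    · simp only [mem_filter, mem_univ, true_and] at hy ⊢
      exact ⟨hy.1, hy.2.1, h y hy.2.1 hy.2.2⟩
    · have := @hs w (by simp [hwu, hvw, hvw.ne'])
      exact (mem_filter.mp this).2.2.2
  simp only [SimpleGraph.irrefl, if_false, SimpleGraph.adj_comm _ v u]
  omega

/-- If adjacent-in-a-facet pairs are always nested, there are at least `d` dominating vertices. -/
theorem exists_dominating (hF : IsFacetSystem G d F) (hcard : d < Fintype.card V)
    (hnest : ∀ F', IsFacetSystem G d F' → ∀ K ∈ F', ∀ u ∈ K, ∀ v ∈ K, u ≠ v → NestedAt G u v) :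
    ∃ D : Finset V, #D = d ∧ ∀ x ∈ D, ∀ y, y ≠ x → G.Adj x y := by
  classical
  set D : Finset V := {x | ∀ y, y ≠ x → G.Adj x y} with hD
  have hDmem : ∀ x, x ∈ D ↔ ∀ y, y ≠ x → G.Adj x y := by simp [hD]
  suffices h : d ≤ #D by
    obtain ⟨D', hD', hcard⟩ := exists_subset_card_eq h
    exact ⟨D', hcard, fun x hx => (hDmem x).mp (hD' hx)⟩
  by_contra! hlt
  obtain ⟨u₀, hu₀⟩ : ∃ x, x ∉ D := by
    by_contra! h
    rw [eq_univ_iff_forall.mpr h, card_univ] at hlt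
    omega
  obtain ⟨u, hu, humax⟩ := exists_max_image Dᶜ (fun x => G.degree x) ⟨u₀, mem_compl.mpr hu₀⟩
  rw [mem_compl] at hu
  obtain ⟨S₀, hS₀, huS₀⟩ := hF.cover u
  have key : ∀ T, Relation.ReflTransGen (fun A B => B ∈ F ∧ d ≤ #(A ∩ B)) S₀ T →
      T ∈ F ∧ ∀ w ∈ T, w ≠ u → G.Adj u w := by
    intro T hT
    induction hT with
    | refl => exact ⟨hS₀, fun w hw hwu => hF.clique S₀ hS₀ u huS₀ w hw hwu.symm⟩
    | @tail A B _ h ih =>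
      refine ⟨h.1, fun w hw hwu => ?_⟩
      by_contra huw
      have huB : u ∉ B := fun h' => huw (hF.clique B h.1 u h' w hw hwu.symm)
      have hwA : w ∉ A := fun h' => huw (ih.2 w h' hwu)
      have hR : #(A ∩ B) = d := by
        have : #(A ∩ B) < #B :=
          card_lt_card ⟨inter_subset_right, fun h' => hwA (mem_inter.mp (h' hw)).1⟩
        have := hF.card B h.1
        omega
      have huR : u ∉ A ∩ B := fun h' => huB (mem_inter.mp h').2
      obtain ⟨y, hyR, hyD⟩ := exists_mem_notMem_of_card_lt_card (hR.symm ▸ hlt : #D < #(A ∩ B))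
      have hyB := (mem_inter.mp hyR).2
      have hadj : ∀ z ∈ A ∩ B, G.Adj u z := fun z hz =>
        ih.2 z (mem_inter.mp hz).1 (ne_of_mem_of_not_mem hz huR)
      have hF' : IsFacetSystem G d (Insert.insert (Insert.insert u (A ∩ B)) F) := by
        refine hF.insert h.1 (by rw [card_insert_of_notMem huR, hR]) ?_ ?_
        · intro x hx z hz hxz
          rcases mem_insert.mp hx with rfl | hx'
          · exact hadj z (mem_of_mem_insert_of_ne hz hxz.symm)
          · rcases mem_insert.mp hz with rfl | hz'
            · exact (hadj x hx').symm
            · exact hF.clique B h.1 x (mem_inter.mp hx').2 z (mem_inter.mp hz').2 hxz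
        · rw [← hR]
          exact card_le_card (subset_inter inter_subset_right (subset_insert _ _))
      have hyu : y ≠ u := ne_of_mem_of_not_mem hyR huR
      have hyw : y ≠ w := by
        rintro rfl
        exact hwA (mem_inter.mp hyR).1
      have hn := hnest _ hF' _ (Or.inl rfl) u (mem_insert_self _ _) y
        (mem_insert_of_mem hyR) hyu.symm
      have := degree_lt_of_nestedAt hn hwu (hF.clique B h.1 y hyB w hw hyw) huw
      have := humax y (mem_compl.mpr hyD)
      omega
  refine hu ((hDmem u).mpr fun w hwu => ?_)
  obtain ⟨T, hT, hwT⟩ := hF.cover w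
  exact (key T (hF.connected S₀ hS₀ T hT)).2 w hwT hwu

open Classical in
/-- A graph with a facet system can be compressed, without decreasing `τ₀`, to a graph with `d`
dominating vertices and nested neighbourhoods. -/
theorem exists_nested_tau0_ge (hF : IsFacetSystem G d F) (hcard : d < Fintype.card V) :
    ∃ H : SimpleGraph V, tau0 G ≤ tau0 H ∧ ∑ x, H.degree x = ∑ x, G.degree x ∧
      (∃ D : Finset V, #D = d ∧ ∀ x ∈ D, ∀ y, y ≠ x → H.Adj x y) ∧
      ∀ u v, u ≠ v → NestedAt H u v := by
  let C : Set (SimpleGraph V) := {H | tau0 G ≤ tau0 H ∧ ∑ x, H.degree x = ∑ x, G.degree x ∧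
    ∃ F', IsFacetSystem H d F'}
  obtain ⟨H, ⟨hτ, hdeg, F₀, hF₀⟩, hmax⟩ :=
    C.toFinite.exists_maximalFor (fun H : SimpleGraph V => ∑ x, H.degree x ^ 2) C
      ⟨G, le_rfl, rfl, F, hF⟩
  have hnest : ∀ u v, u ≠ v → (∃ F', IsFacetSystem (compression H u v) d F') →
      NestedAt H u v := by
    intro u v huv hF'
    by_contra hn
    have hlt := sum_degree_sq_lt huv hn
    have := hmax (j := compression H u v) ⟨hτ.trans (tau0_le_tau0_compression H huv),
      (sum_degree_compression huv).trans hdeg, hF'⟩ hlt.le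
    exact absurd this (not_le.mpr hlt)
  obtain ⟨D, hDcard, hD⟩ := exists_dominating hF₀ hcard fun F' hF' K hK u hu v hv huv =>
    hnest u v huv ⟨_, hF'.compression huv hK hu hv⟩
  refine ⟨H, hτ, hdeg, ⟨D, hDcard, hD⟩, fun u v huv => ?_⟩
  by_cases hu : u ∈ D
  · exact Or.inr fun w hwu _ => hD u hu w hwu
  by_cases hv : v ∈ D
  · exact Or.inl fun w hwv _ => hD v hv w hwv
  refine hnest u v huv (isFacetSystem_of_dominating hcard hDcard fun x hx y hyx => ?_)
  have hxu := ne_of_mem_of_not_mem hx hu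
  have hxv := ne_of_mem_of_not_mem hx hv
  by_cases hyu : y = u
  · subst hyu
    exact ((compression_adj_left hxu hxv huv).mpr (Or.inl (hD x hx y hyx).symm)).symm
  by_cases hyv : y = v
  · subst hyv
    exact ((compression_adj_right hxu hxv huv).mpr
      ⟨(hD x hx u hxu.symm).symm, (hD x hx y hyx).symm⟩).symm
  exact (compression_adj_of_ne hxu hxv hyu hyv).mpr (hD x hx y hyx)

end FacetSystems

section Convexity

/-- The probability that a given vertex, but none of `b` further ones, belongs to a random set. -/
def isolationWeight (b : ℕ) : ℚ := 1 / (((b : ℚ) + 1) * ((b : ℚ) + 2))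

theorem isolationWeight_slope (c : ℕ) :
    isolationWeight (c + 1) - isolationWeight c =
      -2 / (((c : ℚ) + 1) * ((c : ℚ) + 2) * ((c : ℚ) + 3)) := by
  unfold isolationWeight
  push_cast
  field_simp
  ring

theorem isolationWeight_slope_mono {c b : ℕ} (h : c ≤ b) :
    isolationWeight (c + 1) - isolationWeight c ≤
      isolationWeight (b + 1) - isolationWeight b := by
  rw [isolationWeight_slope, isolationWeight_slope, neg_div, neg_div, neg_le_neg_iff]
  have : (c : ℚ) ≤ b := by exact_mod_cast h
  gcongr

theorem isolationWeight_slope_mul_le {c a b : ℕ} (h : c ≤ a ∧ a ≤ b ∨ b ≤ a ∧ a ≤ c) :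
    (isolationWeight (c + 1) - isolationWeight c) * ((b : ℚ) - a) ≤
      isolationWeight b - isolationWeight a := by
  rcases h with ⟨hca, hab⟩ | ⟨hba, hac⟩
  · induction b, hab using Nat.le_induction with
    | base => simp
    | succ b hab ih =>
      have := isolationWeight_slope_mono (hca.trans hab)
      push_cast
      linarith
  · induction a, hba using Nat.le_induction with
    | base => simp
    | succ a hba ih =>
      have := isolationWeight_slope_mono (Nat.le_of_succ_le hac)
      have := ih (Nat.le_of_succ_le hac)
      push_cast
      linarith

theorem sum_isolationWeight_range (k : ℕ) :
    ∑ i ∈ range k, isolationWeight i = 1 - 1 / ((k : ℚ) + 1) := by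
  induction k with
  | zero => simp
  | succ k ih =>
    rw [sum_range_succ, ih, isolationWeight]
    push_cast
    field_simp
    ring

theorem sum_range_eq_choose_two (k : ℕ) : ∑ i ∈ range k, i = k.choose 2 := by
  rw [sum_range_id, Nat.choose_two_right]

/-- Among sequences of back degrees, the sequence `0, …, k - 1, j, d, …, d` maximizes the total
isolation weight. -/
theorem sum_isolationWeight_le {n d f k j : ℕ} (a : ℕ → ℕ) (hdn : d < n)
    (hle : ∀ i < n, a i ≤ i) (hmin : ∀ i < n, min d i ≤ a i)
    (hanti : ∀ i l, i < l → l < n → a i = i ∨ a l ≤ a i)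
    (hsum : ∑ i ∈ range n, a i = f) (hf : f < n.choose 2) (hkn : k ≤ n)
    (hk : k.choose 2 + (n - k) * d ≤ f)
    (hkmax : ∀ k', k' ≤ n → k'.choose 2 + (n - k') * d ≤ f → k' ≤ k)
    (hj : (j : ℤ) = (f : ℤ) - (k.choose 2 : ℤ) - ((n : ℤ) - (k : ℤ) - 1) * (d : ℤ)) :
    d + 1 ≤ k ∧ k + 1 ≤ n ∧ d ≤ j ∧ j + 1 ≤ k ∧
      ∑ i ∈ range n, isolationWeight (a i) ≤
        1 - 1 / ((k : ℚ) + 1) + isolationWeight j +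
          ((n : ℚ) - (k : ℚ) - 1) * isolationWeight d := by
  have hdk : d + 1 ≤ k := by
    refine hkmax _ hdn ?_
    obtain ⟨m, rfl⟩ := Nat.exists_eq_add_of_le (Nat.succ_le_of_lt hdn)
    rw [← hsum, sum_range_add, ← sum_range_eq_choose_two, Nat.succ_eq_add_one,
      Nat.add_sub_cancel_left, ← smul_eq_mul]
    refine add_le_add (sum_le_sum fun i hi => ?_)
      (le_of_eq_of_le (by simp) (card_nsmul_le_sum (range m) _ d fun i hi => ?_))
    · have h1 := mem_range.mp hi
      have := hmin i (by omega)
      omega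
    · have h1 := mem_range.mp hi
      have := hmin (d + 1 + i) (by omega)
      omega
  have hkn' : k + 1 ≤ n := by
    by_contra h
    obtain rfl : k = n := by omega
    omega
  obtain ⟨m, rfl⟩ := Nat.exists_eq_add_of_le hkn'
  have hjf : f = k.choose 2 + m * d + j := by
    zify
    push_cast at hj
    linarith
  have hchoose : (k + 1).choose 2 = k.choose 2 + k := by
    rw [← sum_range_eq_choose_two, sum_range_succ, sum_range_eq_choose_two]
  have hdj : d ≤ j := by
    rw [show k + 1 + m - k = m + 1 by omega, add_mul] at hk
    omega
  have hmax : f < (k + 1).choose 2 + m * d := by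
    by_contra! h
    have := hkmax (k + 1) hkn' (by rwa [Nat.add_sub_cancel_left])
    omega
  have hjk : j + 1 ≤ k := by omega
  refine ⟨hdk, hkn', hdj, hjk, ?_⟩
  have htail : ∀ i, k < i → i < k + 1 + m → d ≤ a i ∧ a i ≤ a k := by
    have hda : ∀ i, k < i → i < k + 1 + m → d ≤ a i := fun i hi hin => by
      have := hmin i hin
      omega
    refine fun i hi hin => ⟨hda i hi hin, (hanti k i hi hin).resolve_left fun hak => ?_⟩
    refine absurd hmax (not_lt.mpr ?_)
    rw [← hsum, sum_range_add, ← sum_range_eq_choose_two]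
    refine add_le_add (sum_le_sum fun i hi => ?_)
      (le_of_eq_of_le (by simp) (card_nsmul_le_sum (range m) _ d fun i hi => ?_))
    · have h1 := mem_range.mp hi
      rcases Nat.lt_succ_iff_lt_or_eq.mp h1 with h2 | rfl
      · have := hle i (by omega)
        have := hanti i k h2 (by omega)
        omega
      · exact hak.ge
    · have h1 := mem_range.mp hi
      exact hda _ (by omega) (by omega)
  set b : ℕ → ℕ := fun i => if i < k then i else if i = k then j else d with hb
  have hbsum : ∀ {M : Type} [AddCommMonoid M] (g : ℕ → M), ∑ i ∈ range (k + 1 + m), g (b i) =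
      ∑ i ∈ range k, g i + g j + m • g d := by
    intro M _ g
    rw [sum_range_add, sum_range_succ]
    congr 1
    · congr 1
      · exact sum_congr rfl fun i hi => by simp [hb, mem_range.mp hi]
      · simp [hb]
    · rw [← card_range m, ← sum_const, card_range]
      refine sum_congr rfl fun i _ => ?_
      simp [hb, show ¬ k + 1 + i < k by omega, show k + 1 + i ≠ k by omega]
  have hab : ∑ i ∈ range (k + 1 + m), b i = ∑ i ∈ range (k + 1 + m), a i := by
    have := hbsum (fun i => i)
    rw [this, hsum, hjf, sum_range_eq_choose_two, smul_eq_mul]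
    ring
  have hpoint : ∀ i ∈ range (k + 1 + m),
      (isolationWeight (a k + 1) - isolationWeight (a k)) * ((b i : ℚ) - a i) ≤
        isolationWeight (b i) - isolationWeight (a i) := by
    intro i hi
    have hin := mem_range.mp hi
    refine isolationWeight_slope_mul_le ?_
    rcases lt_trichotomy i k with h | rfl | h
    · have := hle i hin
      have := hanti i k h (by omega)
      have : b i = i := by simp [hb, h]
      have := le_total (a k) (a i)
      omega
    · have := le_total (a i) (b i)
      omega
    · have := htail i h hin
      have : b i = d := by simp [hb, h.not_gt, h.ne']
      omega
  have htotal := sum_le_sum hpoint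
  have hab' : ∑ i ∈ range (k + 1 + m), (b i : ℚ) = ∑ i ∈ range (k + 1 + m), (a i : ℚ) := by
    exact_mod_cast hab
  rw [← mul_sum, sum_sub_distrib, sum_sub_distrib, hab', sub_self, mul_zero,
    hbsum isolationWeight, sum_isolationWeight_range, nsmul_eq_mul] at htotal
  push_cast
  linarith

end Convexity

section BackDegrees

variable {V : Type*} [Fintype V]

open Classical in
theorem exists_rank_degree_antitone (H : SimpleGraph V) :
    ∃ e : V ≃ Fin (Fintype.card V), ∀ x y, e x < e y → H.degree y ≤ H.degree x := by
  let e₀ := Fintype.equivFin V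
  let deg : V → ℕ := fun x => H.degree x
  let f : Fin (Fintype.card V) → ℕᵒᵈ := fun i => OrderDual.toDual (deg (e₀.symm i))
  refine ⟨e₀.trans (Tuple.sort f).symm, fun x y hxy => ?_⟩
  have := Tuple.monotone_sort f hxy.le
  rw [Function.comp_apply, Function.comp_apply, Equiv.trans_apply, Equiv.trans_apply,
    Equiv.apply_symm_apply, Equiv.apply_symm_apply] at this
  change deg y ≤ deg x
  simpa [f] using this

open Classical in
theorem two_mul_sum_card_back (H : SimpleGraph V) (r : V → ℕ) (hr : Function.Injective r) :
    2 * ∑ x, #{y | r y < r x ∧ H.Adj y x} = ∑ x, H.degree x := by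
  have hswap : ∑ x, #{y | r x < r y ∧ H.Adj y x} = ∑ x, #{y | r y < r x ∧ H.Adj y x} := by
    simp only [card_filter]
    rw [sum_comm]
    simp only [H.adj_comm]
  rw [two_mul]
  nth_rewrite 2 [← hswap]
  rw [← sum_add_distrib]
  refine sum_congr rfl fun x _ => ?_
  rw [← card_union_of_disjoint, ← SimpleGraph.card_neighborFinset_eq_degree]
  · congr 1
    ext y
    simp only [mem_union, mem_filter, mem_univ, true_and, SimpleGraph.mem_neighborFinset,
      H.adj_comm x y]
    refine ⟨fun h => h.elim And.right And.right, fun h => ?_⟩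
    rcases lt_or_gt_of_ne (hr.ne h.ne) with h' | h'
    exacts [Or.inl ⟨h', h⟩, Or.inr ⟨h', h⟩]
  · rw [disjoint_filter]
    rintro y - ⟨h, -⟩ ⟨h', -⟩
    omega

theorem card_filter_equiv_fin_lt (e : V ≃ Fin (Fintype.card V)) {m : ℕ}
    (hm : m ≤ Fintype.card V) : #{y | (e y : ℕ) < m} = m := by
  rw [card_equiv e (t := {i : Fin (Fintype.card V) | (i : ℕ) < m}) (by simp)]
  rw [Fin.card_filter_val_lt, min_eq_right hm]

variable [DecidableEq V] {H : SimpleGraph V} {d : ℕ}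

open Classical in
/-- The back degrees of a graph with nested neighbourhoods and `d` dominating vertices, ordered
by decreasing degree. -/
theorem exists_backDegree_sequence {D : Finset V} (hcard : #D = d)
    (hD : ∀ x ∈ D, ∀ y, y ≠ x → H.Adj x y) (hnest : ∀ u v, u ≠ v → NestedAt H u v) :
    ∃ a : ℕ → ℕ, (∀ i < Fintype.card V, a i ≤ i) ∧ (∀ i < Fintype.card V, min d i ≤ a i) ∧
      (∀ i l, i < l → l < Fintype.card V → a i = i ∨ a l ≤ a i) ∧
      2 * ∑ i ∈ range (Fintype.card V), a i = ∑ x, H.degree x ∧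
      tau0 H ≤ ∑ i ∈ range (Fintype.card V), isolationWeight (a i) -
        (1 - ((Fintype.card V : ℚ) + 1)⁻¹) := by
  obtain ⟨e, he⟩ := exists_rank_degree_antitone H
  let r : V → ℕ := fun x => e x
  have hr : Function.Injective r := Fin.val_injective.comp e.injective
  let B : V → Finset V := fun x => {y | r y < r x ∧ H.Adj y x}
  have hB : ∀ x y, y ∈ B x ↔ r y < r x ∧ H.Adj y x := fun x y => by simp [B]
  have hlt : ∀ x, r x < Fintype.card V := fun x => (e x).isLt
  have hshift : ∀ x y w, r x < r y → w ≠ x → H.Adj y w → H.Adj x w := by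
    intro x y w hxy hwx hyw
    by_contra hxw
    have hne : x ≠ y := fun h => hxy.ne (h ▸ rfl)
    have := degree_lt_of_nestedAt (hnest x y hne) hwx hyw hxw
    have := he x y hxy
    omega
  have hinit : ∀ m ≤ Fintype.card V, #{y | r y < m} = m := fun m hm =>
    card_filter_equiv_fin_lt e hm
  have hBsub : ∀ x, B x ⊆ ({y | r y < r x} : Finset V) := fun x y hy => by
    simpa using ((hB x y).mp hy).1
  have hBle : ∀ x, #(B x) ≤ r x := fun x =>
    (card_le_card (hBsub x)).trans (hinit _ (hlt x).le).le
  have hdom : ∀ x, r x < d → ∀ y, y ≠ x → H.Adj x y := by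
    intro x hx
    by_contra! h
    obtain ⟨y, hyx, hxy⟩ := h
    have hsub : D ⊆ ({y | r y < r x} : Finset V) := by
      intro w hw
      rw [mem_filter]
      refine ⟨mem_univ w, ?_⟩
      by_contra! hle
      have hwx : w ≠ x := by
        rintro rfl
        exact hxy (hD w hw y hyx)
      have hyw : y ≠ w := by
        rintro rfl
        exact hxy (hD y hw x hwx.symm).symm
      exact hxy (hshift x w y (lt_of_le_of_ne hle (hr.ne hwx.symm)) hyx (hD w hw y hyw))
    have := card_le_card hsub
    rw [hinit _ (hlt x).le] at this
    omega
  have hmin : ∀ x, min d (r x) ≤ #(B x) := by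
    intro x
    rw [← hinit (min d (r x)) ((min_le_right _ _).trans (hlt x).le)]
    refine card_le_card fun y hy => ?_
    have hy' := lt_min_iff.mp (mem_filter.mp hy).2
    refine (hB x y).mpr ⟨hy'.2, hdom y hy'.1 x fun h => ?_⟩
    exact absurd hy'.2 (h ▸ lt_irrefl _)
  have hanti : ∀ x z, r x < r z → #(B x) = r x ∨ #(B z) ≤ #(B x) := by
    intro x z hxz
    by_cases hfull : ({y | r y < r x} : Finset V) ⊆ B x
    · left
      rw [(hBsub x).antisymm hfull, hinit _ (hlt x).le]
    right
    obtain ⟨t, ht, htB⟩ := not_subset.mp hfull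
    have htx : r t < r x := (mem_filter.mp ht).2
    have htadj : ¬ H.Adj t x := fun h => htB ((hB x t).mpr ⟨htx, h⟩)
    have hxz' : ¬ H.Adj z x := fun h => htadj (hshift t z x (htx.trans hxz)
      (fun h => htx.ne (h ▸ rfl)) h)
    refine card_le_card fun s hs => ?_
    obtain ⟨hsz, hadj⟩ := (hB z s).mp hs
    rcases lt_trichotomy (r s) (r x) with h | h | h
    · exact (hB x s).mpr ⟨h, (hshift x z s hxz (fun h' => h.ne (h' ▸ rfl)) hadj.symm).symm⟩
    · exact absurd (hr h ▸ hadj.symm) hxz'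
    · exact absurd (hshift x s z h (fun h' => hxz.ne (h' ▸ rfl)) hadj).symm hxz'
  let a : ℕ → ℕ := fun i => if h : i < Fintype.card V then #(B (e.symm ⟨i, h⟩)) else 0
  have ha : ∀ x, a (r x) = #(B x) := fun x => by simp [a, r]
  have hsurj : ∀ i < Fintype.card V, ∃ x, r x = i := fun i hi =>
    ⟨e.symm ⟨i, hi⟩, by simp [r]⟩
  have hsum : ∀ {M : Type} [AddCommMonoid M] (g : ℕ → M),
      ∑ x, g #(B x) = ∑ i ∈ range (Fintype.card V), g (a i) := by
    intro M _ g
    rw [← Fin.sum_univ_eq_sum_range (fun i => g (a i))]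
    exact Fintype.sum_equiv e _ _ fun x => by rw [← ha]
  refine ⟨a, ?_, ?_, ?_, ?_, ?_⟩
  · intro i hi
    obtain ⟨x, rfl⟩ := hsurj i hi
    exact (ha x).trans_le (hBle x)
  · intro i hi
    obtain ⟨x, rfl⟩ := hsurj i hi
    exact (hmin x).trans_eq (ha x).symm
  · intro i l hil hl
    obtain ⟨x, rfl⟩ := hsurj i (hil.trans hl)
    obtain ⟨z, rfl⟩ := hsurj l hl
    rw [ha, ha]
    exact hanti x z hil
  · rw [← two_mul_sum_card_back H r hr, ← hsum (fun i => i)]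
  · rw [← hsum isolationWeight]
    exact tau0_le_of_order H r B hB

end BackDegrees

theorem isFacetSystem_complexGraph {V : Type*} [DecidableEq V] {d : ℕ} {F : Finset (Finset V)}
    (hfacet : ∀ S ∈ F, #S = d + 1) (hcover : ∀ v : V, ∃ S ∈ F, v ∈ S)
    (hsc : (dualGraph F d).Connected) : IsFacetSystem (complexGraph F) d {S | S ∈ F} where
  card := hfacet
  clique S hS x hx y hy hxy := ⟨hxy, Or.inl ⟨S, hS, hx, hy⟩⟩
  cover := hcover
  connected S hS T hT := by
    have h := (SimpleGraph.reachable_iff_reflTransGen _ _).mp (hsc.preconnected ⟨S, hS⟩ ⟨T, hT⟩)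
    refine h.lift Subtype.val fun A B hAB => ⟨B.2, ?_⟩
    rcases hAB.2 with h | h
    · exact h.ge
    · rw [inter_comm]
      exact h.ge

open Classical in
theorem sum_degree_eq_two_mul_natCard_edgeSet {V : Type*} [Fintype V] (G : SimpleGraph V) :
    ∑ x, G.degree x = 2 * Nat.card G.edgeSet := by
  rw [SimpleGraph.sum_degrees_eq_twice_card_edges, Nat.card_eq_fintype_card,
    SimpleGraph.edgeFinset_card]

/-- a strongly connected pure `d`-complex with `f₀` vertices and `f₁ < C(f₀,2)`
edges satisfies `τ₀(C) ≤ τ₀` of the Billera–Lee graph with parameters `(f₀, f₁, d)`, where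
`k` is the largest integer with `k ≤ f₀` and `C(k,2) + (f₀−k)·d ≤ f₁`, and
`j = f₁ − C(k,2) − (f₀−k−1)·d`; moreover `d+1 ≤ k ≤ f₀−1` and `d ≤ j ≤ k−1`. -/
theorem tau0_le_billeraLee_bound {V : Type*} [Fintype V] [DecidableEq V]
    (d : ℕ) (hd : 1 ≤ d) (F : Finset (Finset V)) (hne : F.Nonempty)
    (hfacet : ∀ S ∈ F, S.card = d + 1)
    (hcover : ∀ v : V, ∃ S ∈ F, v ∈ S)
    (hsc : (dualGraph F d).Connected)
    (f₁ k j : ℕ)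
    (hf₁ : f₁ = Nat.card (complexGraph F).edgeSet)
    (hf₁lt : f₁ < (Fintype.card V).choose 2)
    (hk₀ : k ≤ Fintype.card V)
    (hk₁ : k.choose 2 + (Fintype.card V - k) * d ≤ f₁)
    (hkmax : ∀ k', k' ≤ Fintype.card V →
      k'.choose 2 + (Fintype.card V - k') * d ≤ f₁ → k' ≤ k)
    (hj : (j : ℤ) = (f₁ : ℤ) - (k.choose 2 : ℤ)
      - ((Fintype.card V : ℤ) - (k : ℤ) - 1) * (d : ℤ)) :
    d + 1 ≤ k ∧ k + 1 ≤ Fintype.card V ∧ d ≤ j ∧ j + 1 ≤ k ∧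
      tau0 (complexGraph F)
        ≤ 1 / ((Fintype.card V : ℚ) + 1) - 1 / ((k : ℚ) + 1)
          + 1 / (((j : ℚ) + 1) * ((j : ℚ) + 2))
          + ((Fintype.card V : ℚ) - (k : ℚ) - 1) / (((d : ℚ) + 1) * ((d : ℚ) + 2)) := by
  have hcard : d < Fintype.card V := by
    obtain ⟨S, hS⟩ := hne
    have := card_le_univ S
    rwa [hfacet S hS] at this
  obtain ⟨H, hτ, hdeg, ⟨D, hDcard, hD⟩, hnest⟩ :=
    exists_nested_tau0_ge (isFacetSystem_complexGraph hfacet hcover hsc) hcard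
  obtain ⟨a, hle, hmin, hanti, hsum, hτ'⟩ := exists_backDegree_sequence hDcard hD hnest
  have hsum' : ∑ i ∈ range (Fintype.card V), a i = f₁ := by
    have := sum_degree_eq_two_mul_natCard_edgeSet (complexGraph F)
    omega
  obtain ⟨h₁, h₂, h₃, h₄, h⟩ :=
    sum_isolationWeight_le a hcard hle hmin hanti hsum' hf₁lt hk₀ hk₁ hkmax hj
  refine ⟨h₁, h₂, h₃, h₄, ?_⟩
  simp only [isolationWeight, one_div, ← div_eq_mul_inv] at *
  linarith
end
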